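/- For every fair division instance with social impact (with n agents and additive valuations and social impacts), there exists an EF1 allocation A such that 2n² · SW(A) ≥ opt, i.e., an EF1 allocation that is an O(n²)-approximation of the maximum utilitarian social welfare. -/

import Mathlib

open Finset

/-- An allocation: pairwise disjoint bundles covering all goods. -/
def IsAllocation {n : ℕ} {G : Type} (A : Fin n → Finset G) : Prop :=
  (∀ i j, i ≠ j → Disjoint (A i) (A j)) ∧ ∀ g, ∃ i, g ∈ A i

/-- Utilitarian social welfare with respect to additive social impacts `s`. -/
def SW {n : ℕ} {G : Type} (s : Fin n → G → NNReal) (A : Fin n → Finset G) : NNReal :=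
  ∑ i, ∑ g ∈ A i, s i g

/-- Envy-freeness up to one good for additive valuations `v`. -/
def EF1 {n : ℕ} {G : Type} [DecidableEq G] (v : Fin n → G → NNReal)
    (A : Fin n → Finset G) : Prop :=
  ∀ i j, A j = ∅ ∨ ∃ g ∈ A j, ∑ g' ∈ (A j).erase g, v i g' ≤ ∑ g' ∈ A i, v i g'

/-- The bundles `A` are pairwise disjoint with union `S`. -/
def IsPartitionOf {N G : Type} (A : N → Finset G) (S : Finset G) : Prop :=
  (∀ i j, i ≠ j → Disjoint (A i) (A j)) ∧ ∀ g, (∃ i, g ∈ A i) ↔ g ∈ S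

/-- The `u`-value of `B` is at most `x` after the removal of at most one good. -/
def AtMostUpToOne {G : Type} [DecidableEq G] (u : G → NNReal) (B : Finset G) (x : NNReal) : Prop :=
  B = ∅ ∨ ∃ g ∈ B, ∑ g' ∈ B.erase g, u g' ≤ x

section Allocations

variable {N G : Type}

theorem IsPartitionOf.subset {A : N → Finset G} {S : Finset G} (hA : IsPartitionOf A S) (a : N) :
    A a ⊆ S := fun g hg => (hA.2 g).1 ⟨a, hg⟩

variable [DecidableEq G]

theorem AtMostUpToOne.mono {u : G → NNReal} {B : Finset G} {x y : NNReal}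
    (h : AtMostUpToOne u B x) (hxy : x ≤ y) : AtMostUpToOne u B y :=
  h.imp_right fun ⟨g, hg, hle⟩ => ⟨g, hg, hle.trans hxy⟩

theorem AtMostUpToOne.of_le {u : G → NNReal} {B : Finset G} {x : NNReal}
    (h : ∑ g ∈ B, u g ≤ x) : AtMostUpToOne u B x := by
  rcases B.eq_empty_or_nonempty with rfl | ⟨g, hg⟩
  · exact Or.inl rfl
  · exact Or.inr ⟨g, hg, (sum_le_sum_of_subset (erase_subset g B)).trans h⟩

theorem AtMostUpToOne.insert {u : G → NNReal} {B : Finset G} {x : NNReal} {g : G}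
    (hg : g ∉ B) (h : ∑ g' ∈ B, u g' ≤ x) : AtMostUpToOne u (insert g B) x :=
  Or.inr ⟨g, mem_insert_self g B, by rwa [erase_insert hg]⟩

theorem AtMostUpToOne.sum_le {u : G → NNReal} {B : Finset G} {x y : NNReal}
    (h : AtMostUpToOne u B x) (hy : ∀ g ∈ B, u g ≤ y) : ∑ g ∈ B, u g ≤ y + x := by
  rcases h with rfl | ⟨g, hg, hle⟩
  · simp
  · rw [← add_sum_erase B u hg]
    exact add_le_add (hy g hg) hle

theorem AtMostUpToOne.union {u : G → NNReal} {B P : Finset G} {x y : NNReal}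
    (h : AtMostUpToOne u B x) (hP : ∑ g ∈ P, u g ≤ y) (hd : Disjoint B P) :
    AtMostUpToOne u (B ∪ P) (x + y) := by
  rcases h with rfl | ⟨g, hg, hle⟩
  · rw [empty_union]
    exact (AtMostUpToOne.of_le hP).mono le_add_self
  · refine Or.inr ⟨g, mem_union_left P hg, ?_⟩
    have hgP : g ∉ P := disjoint_left.1 hd hg
    rw [erase_union_distrib, erase_eq_of_notMem hgP,
      sum_union (hd.mono_left (erase_subset g B))]
    exact add_le_add hle hP

theorem AtMostUpToOne.union_of_card_le_one {u : G → NNReal} {B P : Finset G} {x : NNReal}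
    (h : ∑ g ∈ B, u g ≤ x) (hd : Disjoint B P) (hP : P.card ≤ 1) :
    AtMostUpToOne u (B ∪ P) x := by
  rcases P.eq_empty_or_nonempty with rfl | hne
  · rw [union_empty]
    exact .of_le h
  · obtain ⟨p, rfl⟩ := card_eq_one.1 (le_antisymm hP hne.card_pos)
    rw [union_comm, ← insert_eq]
    exact .insert (by simpa using hd) h

theorem IsPartitionOf.sum [Fintype N] {A : N → Finset G} {S : Finset G} (hA : IsPartitionOf A S)
    (u : G → NNReal) : ∑ a, ∑ g ∈ A a, u g = ∑ g ∈ S, u g := by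
  classical
  rw [← sum_biUnion fun a _ b _ hab => hA.1 a b hab]
  congr 1
  ext g
  simp [hA.2 g]

theorem IsPartitionOf.update_insert [DecidableEq N] {A : N → Finset G} {S : Finset G} {g : G}
    (hA : IsPartitionOf A (S.erase g)) (hg : g ∈ S) (a : N) :
    IsPartitionOf (Function.update A a (insert g (A a))) S := by
  have hgA : ∀ b, g ∉ A b := fun b h => notMem_erase g S (hA.subset b h)
  constructor
  · intro i j hij
    have := hA.1 i j hij
    by_cases hi : i = a <;> by_cases hj : j = a <;>
      simp_all
  · intro x
    have := hA.2 x
    constructor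
    · rintro ⟨b, hb⟩
      have := hA.subset b
      have := hA.subset a
      grind [Function.update_apply]
    · intro hx
      by_cases hxg : x = g
      · exact ⟨a, by simp [hxg]⟩
      · obtain ⟨b, hb⟩ := this.2 (mem_erase.2 ⟨hxg, hx⟩)
        exact ⟨b, by grind [Function.update_apply]⟩

theorem IsPartitionOf.union {A P : N → Finset G} {S T : Finset G} (hA : IsPartitionOf A (S \ T))
    (hP : IsPartitionOf P T) (hT : T ⊆ S) : IsPartitionOf (fun a => A a ∪ P a) S := by
  have hAP : ∀ a b, Disjoint (A a) (P b) := fun a b =>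
    disjoint_of_subset_left (hA.subset a)
      (disjoint_of_subset_right (hP.subset b) sdiff_disjoint)
  constructor
  · intro i j hij
    simp only [disjoint_union_left, disjoint_union_right]
    exact ⟨⟨hA.1 i j hij, (hAP j i).symm⟩, hAP i j, hP.1 i j hij⟩
  · intro g
    simp only [mem_union, exists_or, hA.2, hP.2, mem_sdiff]
    have := @hT g
    tauto

/-- Round-robin: for every priority order on the agents there is a partition that is envy-free up to
one good in which nobody envies an agent of lower priority. -/
theorem exists_roundRobin [Fintype N] [Nonempty N] [DecidableEq N] (v : N → G → NNReal)
    (S : Finset G) (r : N → ℕ) :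
    r.Injective → ∃ A : N → Finset G, IsPartitionOf A S ∧
      (∀ a b, r a < r b → ∑ g ∈ A b, v a g ≤ ∑ g ∈ A a, v a g) ∧
      ∀ a b, AtMostUpToOne (v a) (A b) (∑ g ∈ A a, v a g) := by
  induction hk : S.card generalizing S r with
  | zero =>
    intro _
    rw [card_eq_zero] at hk
    subst hk
    exact ⟨fun _ => ∅, by simp [IsPartitionOf], by simp, fun _ _ => Or.inl rfl⟩
  | succ k ih =>
    intro hr
    obtain ⟨f, hf⟩ := Finite.exists_min r
    obtain ⟨g, hgS, hg⟩ := exists_max_image S (v f) (card_pos.1 (by omega))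
    obtain ⟨l, hl⟩ := Finite.exists_max r
    have hr' : (Function.update r f (r l + 1)).Injective := by
      intro a b hab
      have := hl a
      have := hl b
      have := @hr a b
      grind [Function.update_apply]
    obtain ⟨A, hA, henvy, hone⟩ := ih (S.erase g) _ (by rw [card_erase_of_mem hgS]; omega) hr'
    have hgA : ∀ b, g ∉ A b := fun b h => notMem_erase g S (hA.subset b h)
    have hlast : ∀ a, a ≠ f → ∑ x ∈ A f, v a x ≤ ∑ x ∈ A a, v a x := by
      intro a ha
      apply henvy
      have := hl a
      simp only [Function.update_self, Function.update_of_ne ha]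
      omega
    have hfirst : ∀ b, b ≠ f → ∑ x ∈ A b, v f x ≤ ∑ x ∈ insert g (A f), v f x := by
      intro b hb
      rw [sum_insert (hgA f)]
      exact (hone f b).sum_le fun x hx => hg x (mem_of_mem_erase (hA.subset b hx))
    refine ⟨_, hA.update_insert hgS f, ?_, ?_⟩
    · intro a b hab
      have hbf : b ≠ f := fun h => absurd (hf a) (by subst h; omega)
      rw [Function.update_of_ne hbf]
      by_cases haf : a = f
      · subst haf
        simpa using hfirst b hbf
      · rw [Function.update_of_ne haf]
        exact henvy a b (by simpa [Function.update_of_ne haf, Function.update_of_ne hbf] using hab)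
    · intro a b
      by_cases haf : a = f <;> by_cases hbf : b = f
      · subst haf hbf
        exact .of_le le_rfl
      · subst haf
        rw [Function.update_of_ne hbf, Function.update_self]
        exact .of_le (hfirst b hbf)
      · subst hbf
        rw [Function.update_of_ne haf, Function.update_self]
        exact .insert (hgA b) (hlast a haf)
      · rw [Function.update_of_ne haf, Function.update_of_ne hbf]
        exact hone a b

/-- There is an allocation of `S`, envy-free up to one good, that gives a prescribed good to a
prescribed agent. -/
theorem exists_upToOne_mem [Fintype N] [DecidableEq N] (v : N → G → NNReal)
    (S : Finset G) {g : G} (hg : g ∈ S) (i : N) :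
    ∃ A : N → Finset G, IsPartitionOf A S ∧ g ∈ A i ∧
      ∀ a b, AtMostUpToOne (v a) (A b) (∑ g ∈ A a, v a g) := by
  have : Nonempty N := ⟨i⟩
  let e := Fintype.equivFin N
  let r : N → ℕ := Function.update (fun a => (e a : ℕ)) i (Fintype.card N)
  have hr : r.Injective := by
    intro a b hab
    have := (e a).2
    have := (e b).2
    have := e.injective (a₁ := a) (a₂ := b)
    grind [Function.update_apply]
  obtain ⟨A, hA, henvy, hone⟩ := exists_roundRobin v (S.erase g) r hr
  have hgA : g ∉ A i := fun h => notMem_erase g S (hA.subset i h)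
  refine ⟨_, hA.update_insert hg i, by simp, fun a b => ?_⟩
  by_cases hb : b = i
  · subst hb
    by_cases ha : a = b
    · subst ha
      exact .of_le le_rfl
    · rw [Function.update_self, Function.update_of_ne ha]
      refine .insert hgA (henvy a b ?_)
      simp [r, Function.update_of_ne ha]
  · rw [Function.update_of_ne hb]
    refine (hone a b).mono (sum_le_sum_of_subset ?_)
    by_cases ha : a = i
    · subst ha
      simp
    · rw [Function.update_of_ne ha]

/-- Elimination of envy cycles: the bundles can be permuted without loss to anyone so that each
nonempty set of agents has a member not envied by any member. -/
theorem exists_perm_forall_exists_unenvied [Fintype N] (w : N → N → NNReal) :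
    ∃ π : Equiv.Perm N, (∀ a, w a a ≤ w a (π a)) ∧
      ∀ S : Finset N, S.Nonempty → ∃ b ∈ S, ∀ a ∈ S, w a (π b) ≤ w a (π a) := by
  classical
  obtain ⟨π, hπ, hmax⟩ := exists_max_image
    (univ.filter fun π : Equiv.Perm N => ∀ a, w a a ≤ w a (π a)) (fun π => ∑ a, w a (π a))
    ⟨1, by simp⟩
  simp only [mem_filter, mem_univ, true_and] at hπ hmax
  refine ⟨π, hπ, fun S hS => ?_⟩
  by_contra! hcon
  choose f hfS hf using hcon
  let F : S → S := fun b => ⟨f b b.2, hfS b b.2⟩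
  have hF : ∀ b : S, w (F b) (π (F b)) < w (F b) (π b) := fun b => hf b b.2
  let E : Equiv.Perm (Function.periodicPts F) := (Function.bijOn_periodicPts F).equiv F
  let τ : Equiv.Perm S := Equiv.Perm.ofSubtype E.symm
  let σ : Equiv.Perm N := Equiv.Perm.ofSubtype τ
  have hstep : ∀ c : Function.periodicPts F,
      w ((c : S) : N) (π (c : S)) < w ((c : S) : N) (π (σ (c : S))) := by
    intro c
    have h1 : σ (c : S) = ((E.symm c : S) : N) := by
      simp only [σ, Equiv.Perm.ofSubtype_apply_coe, τ]
    have h2 : F (E.symm c : S) = (c : S) := congrArg Subtype.val (E.apply_symm_apply c)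
    have := hF (E.symm c : S)
    rwa [h2, ← h1] at this
  have hle : ∀ a, w a (π a) ≤ w a (π (σ a)) := by
    intro a
    by_cases haS : a ∈ S
    · by_cases hp : (⟨a, haS⟩ : S) ∈ Function.periodicPts F
      · exact (hstep ⟨⟨a, haS⟩, hp⟩).le
      · have h1 : τ ⟨a, haS⟩ = ⟨a, haS⟩ := Equiv.Perm.ofSubtype_apply_of_not_mem _ hp
        have h2 : σ a = τ ⟨a, haS⟩ := Equiv.Perm.ofSubtype_apply_coe τ ⟨a, haS⟩
        rw [h2, h1]
    · rw [show σ a = a from Equiv.Perm.ofSubtype_apply_of_not_mem _ haS]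
  obtain ⟨b, hb⟩ := hS
  obtain ⟨c, hc⟩ : (Function.periodicPts F).Nonempty := by
    obtain ⟨m, k, hmk, h⟩ :=
      Finite.exists_ne_map_eq_of_infinite fun k : ℕ => F^[k] ⟨b, hb⟩
    wlog hlt : m < k generalizing m k
    · exact this k m hmk.symm h.symm (by omega)
    refine ⟨F^[m] ⟨b, hb⟩, Function.mk_mem_periodicPts (Nat.sub_pos_of_lt hlt) ?_⟩
    rw [Function.IsPeriodicPt, Function.IsFixedPt, ← Function.iterate_add_apply,
      Nat.sub_add_cancel hlt.le]
    exact h.symm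
  refine absurd (hmax (σ.trans π) fun a => (hπ a).trans (hle a)) (not_le.2 ?_)
  exact sum_lt_sum (fun a _ => hle a) ⟨c, mem_univ _, hstep ⟨c, hc⟩⟩

/-- If each nonempty set of agents has a member towards which no member stands in relation `R`, a
small set of goods can be handed out, at most one to each agent, without envy along `R`. -/
theorem exists_picks [DecidableEq N] (u : N → G → NNReal) (R : N → N → Prop)
    (hR : ∀ S : Finset N, S.Nonempty → ∃ b ∈ S, ∀ a ∈ S, ¬ R a b) (S : Finset N) (C : Finset G)
    (hCS : C.card ≤ S.card) :
    ∃ P : N → Finset G, IsPartitionOf P C ∧ (∀ a, (P a).card ≤ 1) ∧ (∀ a ∉ S, P a = ∅) ∧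
      ∀ a ∈ S, ∀ b ∈ S, R a b → ∑ g ∈ P b, u a g ≤ ∑ g ∈ P a, u a g := by
  induction hk : S.card generalizing S C with
  | zero =>
    have : C = ∅ := card_eq_zero.1 (by omega)
    subst this
    exact ⟨fun _ => ∅, by simp [IsPartitionOf], by simp, by simp, by simp⟩
  | succ k ih =>
    rcases C.eq_empty_or_nonempty with rfl | hC
    · exact ⟨fun _ => ∅, by simp [IsPartitionOf], by simp, by simp, by simp⟩
    obtain ⟨f, hfS, hf⟩ := hR S (card_pos.1 (by omega))
    obtain ⟨g, hgC, hg⟩ := exists_max_image C (u f) hC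
    obtain ⟨P, hP, hcard, hout, henvy⟩ := ih (S.erase f) (C.erase g)
      (by rw [card_erase_of_mem hfS, card_erase_of_mem hgC]; omega)
      (by rw [card_erase_of_mem hfS]; omega)
    have hPf : P f = ∅ := hout f (notMem_erase f S)
    refine ⟨_, hP.update_insert hgC f, fun a => ?_, fun a ha => ?_, fun a ha b hb hab => ?_⟩
    · by_cases haf : a = f
      · subst haf
        simp [hPf]
      · simpa [haf] using hcard a
    · have haf : a ≠ f := fun h => ha (h ▸ hfS)
      simpa [haf] using hout a fun h => ha (mem_of_mem_erase h)
    · have hbf : b ≠ f := fun h => hf a ha (h ▸ hab)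
      rw [Function.update_of_ne hbf]
      by_cases haf : a = f
      · subst haf
        rw [Function.update_self, hPf, insert_empty, sum_singleton]
        rcases (P b).eq_empty_or_nonempty with h | hne
        · simp [h]
        · obtain ⟨p, hp⟩ := card_eq_one.1 (le_antisymm (hcard b) hne.card_pos)
          rw [hp, sum_singleton]
          exact hg p (mem_of_mem_erase (hP.subset b (by simp [hp])))
      · rw [Function.update_of_ne haf]
        exact henvy a (mem_erase.2 ⟨haf, ha⟩) b (mem_erase.2 ⟨hbf, hb⟩) hab

theorem exists_top_subset (v : G → NNReal) (S : Finset G) (k : ℕ) (hk : k ≤ S.card) :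
    ∃ T ⊆ S, T.card = k ∧ ∀ x ∈ T, ∀ y ∈ S \ T, v y ≤ v x := by
  induction k with
  | zero => exact ⟨∅, by simp⟩
  | succ k ih =>
    obtain ⟨T, hTS, hcard, hT⟩ := ih (by omega)
    obtain ⟨g, hgS, hg⟩ := exists_max_image (S \ T) v
      (card_pos.1 (by rw [card_sdiff_of_subset hTS]; omega))
    have hgT : g ∉ T := (mem_sdiff.1 hgS).2
    refine ⟨insert g T, insert_subset (mem_sdiff.1 hgS).1 hTS, by simp [hgT, hcard], ?_⟩
    intro x hx y hy
    have hy' : y ∈ S \ T := by grind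
    rcases mem_insert.1 hx with rfl | hx
    · exact hg y hy'
    · exact hT x hx y hy'

/-- There is a partition that is envy-free up to one good for `u` and all of whose bundles are
equivalent up to one good for one further valuation `v`. -/
theorem exists_upToOne_balanced [Fintype N] [Nonempty N] (u : N → G → NNReal) (v : G → NNReal)
    (S : Finset G) :
    ∃ A : N → Finset G, IsPartitionOf A S ∧
      (∀ a b, AtMostUpToOne (u a) (A b) (∑ g ∈ A a, u a g)) ∧
      ∀ a b, AtMostUpToOne v (A b) (∑ g ∈ A a, v g) := by
  classical
  induction hk : S.card using Nat.strong_induction_on generalizing S with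
  | _ k ih =>
  rcases S.eq_empty_or_nonempty with rfl | hS
  · exact ⟨fun _ => ∅, by simp [IsPartitionOf], fun _ _ => Or.inl rfl, fun _ _ => Or.inl rfl⟩
  obtain ⟨T, hTS, hTcard, hT⟩ :=
    exists_top_subset v S (min (Fintype.card N) S.card) (min_le_right _ _)
  have hSpos := hS.card_pos
  have hNpos : 0 < Fintype.card N := Fintype.card_pos
  obtain ⟨A', hA', hu', hv'⟩ := ih (S \ T).card (by rw [card_sdiff_of_subset hTS]; omega) _ rfl
  obtain ⟨π, hπ, hsource⟩ := exists_perm_forall_exists_unenvied fun a b => ∑ g ∈ A' b, u a g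
  let A : N → Finset G := fun a => A' (π a)
  have hA : IsPartitionOf A (S \ T) :=
    ⟨fun i j hij => hA'.1 _ _ (π.injective.ne hij), fun g => by
      rw [← hA'.2 g]
      exact (π.surjective.exists (p := fun a => g ∈ A' a)).symm⟩
  have hu : ∀ a b, AtMostUpToOne (u a) (A b) (∑ g ∈ A a, u a g) :=
    fun a b => (hu' a (π b)).mono (hπ a)
  have hv : ∀ a b, AtMostUpToOne v (A b) (∑ g ∈ A a, v g) := fun a b => hv' _ _
  obtain ⟨P, hP, hPcard, -, hPenvy⟩ := exists_picks u
    (fun a b => ∑ g ∈ A a, u a g < ∑ g ∈ A b, u a g)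
    (fun S hS => by simpa only [not_lt] using hsource S hS) univ T
    (by rw [hTcard, card_univ]; exact min_le_left _ _)
  have hAP : ∀ a b, Disjoint (A a) (P b) := fun a b =>
    disjoint_of_subset_left (hA.subset a)
      (disjoint_of_subset_right (hP.subset b) sdiff_disjoint)
  refine ⟨_, hA.union hP hTS, fun a b => ?_, fun a b => ?_⟩
  · rw [sum_union (hAP a a)]
    by_cases h : ∑ g ∈ A a, u a g < ∑ g ∈ A b, u a g
    · exact (hu a b).union (hPenvy a (mem_univ a) b (mem_univ b) h) (hAP b b)
    · exact (AtMostUpToOne.union_of_card_le_one (not_lt.1 h) (hAP b b) (hPcard b)).mono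
        le_self_add
  · rw [sum_union (hAP a a)]
    refine .union_of_card_le_one ?_ (hAP b b) (hPcard b)
    rcases (A b).eq_empty_or_nonempty with h | ⟨x, hx⟩
    · simp [h]
    · rw [add_comm]
      refine (hv a b).sum_le fun y hy => ?_
      have hyS := hA.subset b hy
      have hTN : T.card = Fintype.card N := by
        have := card_pos.2 ⟨y, hyS⟩
        rw [card_sdiff_of_subset hTS] at this
        omega
      have hPne : (P a).Nonempty := by
        by_contra hne
        rw [not_nonempty_iff_eq_empty] at hne
        have h1 : ∑ b, (P b).card = T.card := by
          have := hP.sum fun _ => 1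
          simp only [sum_const, nsmul_eq_mul, mul_one] at this
          exact_mod_cast this
        have h2 : ∑ b, (P b).card < ∑ _b : N, 1 :=
          sum_lt_sum (fun b _ => hPcard b) ⟨a, mem_univ a, by simp [hne]⟩
        simp only [sum_const, card_univ, smul_eq_mul, mul_one] at h2
        omega
      obtain ⟨p, hp⟩ := hPne
      exact (hT p (hP.subset a hp) y hyS).trans
        (single_le_sum (f := v) (fun _ _ => zero_le) hp)

/-- There is an allocation, envy-free up to one good, that gives a prescribed agent a
`1 / (2 * n)` fraction of the total of any prescribed weight function. -/
theorem exists_upToOne_weight_le [Fintype N] (v : N → G → NNReal)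
    (s : G → NNReal) (S : Finset G) (i : N) :
    ∃ A : N → Finset G, IsPartitionOf A S ∧
      (∀ a b, AtMostUpToOne (v a) (A b) (∑ g ∈ A a, v a g)) ∧
      ∑ g ∈ S, s g ≤ 2 * Fintype.card N * ∑ g ∈ A i, s g := by
  classical
  have : Nonempty N := ⟨i⟩
  by_cases hbig : ∃ g ∈ S, ∑ g ∈ S, s g ≤ 2 * Fintype.card N * s g
  · obtain ⟨g, hgS, hg⟩ := hbig
    obtain ⟨A, hA, hgA, hone⟩ := exists_upToOne_mem v S hgS i
    exact ⟨A, hA, hone, hg.trans (mul_le_mul_right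
      (single_le_sum (f := s) (fun _ _ => zero_le) hgA) _)⟩
  · push Not at hbig
    obtain ⟨A, hA, hu, hv⟩ := exists_upToOne_balanced (Function.update v i s) (v i) S
    refine ⟨A, hA, fun a b => ?_, ?_⟩
    · by_cases ha : a = i
      · subst ha
        exact hv a b
      · simpa only [Function.update_of_ne ha] using hu a b
    · set n : NNReal := (Fintype.card N : NNReal) with hn
      have hnpos : 0 < n := by
        rw [hn]
        exact_mod_cast Fintype.card_pos (α := N)
      set t := ∑ g ∈ S, s g with ht
      set x := ∑ g ∈ A i, s g with hx
      have hle : ∀ b, ∑ g ∈ A b, s g ≤ t / (2 * n) + x := by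
        intro b
        have hib := hu i b
        rw [Function.update_self] at hib
        refine hib.sum_le fun g hg => ?_
        rw [le_div_iff₀' (by positivity)]
        exact (hbig g (hA.subset b hg)).le
      have hsum : t ≤ n * (t / (2 * n) + x) := by
        rw [ht, ← hA.sum s]
        refine (sum_le_sum fun b _ => hle b).trans_eq ?_
        rw [sum_const, card_univ, nsmul_eq_mul, ← hn, hA.sum s]
      have hhalf : n * (t / (2 * n) + x) = t / 2 + n * x := by field_simp
      rw [hhalf] at hsum
      have h2 : (t : ℝ) ≤ t / 2 + n * x := by exact_mod_cast hsum
      have h3 : (t : ℝ) ≤ 2 * n * x := by linarith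
      exact_mod_cast h3

end Allocations

/-- For every instance with additive valuations and social impacts, there exists an EF1
allocation `A` that is a `2n²`-approximation of the maximum utilitarian social welfare:
`SW B ≤ 2n² * SW A` for every allocation `B`. -/
theorem ef1_2n2_approx (n m : ℕ) (hn : 0 < n)
    (v s : Fin n → Fin m → NNReal) :
    ∃ A : Fin n → Finset (Fin m), IsAllocation A ∧ EF1 v A ∧
      ∀ B : Fin n → Finset (Fin m), IsAllocation B →
        SW s B ≤ ((2 * n ^ 2 : ℕ) : NNReal) * SW s A := by
  classical
  have : Nonempty (Fin n) := ⟨⟨0, hn⟩⟩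
  obtain ⟨i, hi⟩ := Finite.exists_max fun i => ∑ g, s i g
  obtain ⟨A, hA, hone, hle⟩ := exists_upToOne_weight_le v (s i) univ i
  refine ⟨A, ⟨hA.1, fun g => (hA.2 g).2 (mem_univ g)⟩, hone, fun B _ => ?_⟩
  rw [Fintype.card_fin] at hle
  calc SW s B ≤ ∑ _j : Fin n, ∑ g, s i g :=
        sum_le_sum fun j _ => (sum_le_sum_of_subset (subset_univ (B j))).trans (hi j)
    _ = n * ∑ g, s i g := by simp
    _ ≤ n * (2 * n * ∑ g ∈ A i, s i g) := by gcongr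
    _ = ((2 * n ^ 2 : ℕ) : NNReal) * ∑ g ∈ A i, s i g := by push_cast; ring
    _ ≤ ((2 * n ^ 2 : ℕ) : NNReal) * SW s A := by
        gcongr
        exact single_le_sum (f := fun j => ∑ g ∈ A j, s j g) (fun _ _ => zero_le) (mem_univ i)
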